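/- arXiv:0801.3492 — 7 statements merged into one kernel-verified Lean document; each statement's English description precedes it below -/
import Mathlib

section
/- Let r > 0 and let S be a set of points in the hyperbolic upper half-plane ℍ that is 2r-separated, i.e. dist(w, w') ≥ 2r for all distinct w, w' ∈ S, where dist is the hyperbolic distance. Then for every z ∈ ℍ and all real numbers u, T₀ with u > T₀ > r, the set {w ∈ S : T₀ ≤ dist(z, w) < u} is finite and its cardinality is at most (sinh²((u+r)/2) − sinh²((T₀−r)/2)) / sinh²(r/2). -/
open UpperHalfPlane

open MeasureTheory Real in
/-- The integral of half the chord lengths of a Euclidean disc against `dy / y²`. -/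
theorem integral_sqrt_sub_sq_div_sq {b c ρ : ℝ} (hb : 0 < b) (hρ : 0 < ρ) (hc : 0 < c)
    (h : c ^ 2 = ρ ^ 2 + b ^ 2) :
    ∫ y in (c - ρ)..(c + ρ), √(ρ ^ 2 - (y - c) ^ 2) / y ^ 2 = π * (c / b - 1) := by
  have hcρ : ρ < c := by nlinarith [sq_nonneg (c - ρ), sq_pos_of_pos hb]
  have hpos : ∀ y ∈ Set.Icc (c - ρ) (c + ρ), 0 < y := fun y hy => by linarith [hy.1]
  have hle : c - ρ ≤ c + ρ := by linarith
  set F : ℝ → ℝ := fun y => -(√(ρ ^ 2 - (y - c) ^ 2) / y) +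
    c / b * arcsin ((c * y - b ^ 2) / (ρ * y)) - arcsin ((y - c) / ρ) with hF
  have hcont : ContinuousOn F (Set.Icc (c - ρ) (c + ρ)) := by
    have h1 : ContinuousOn (fun y => √(ρ ^ 2 - (y - c) ^ 2) / y) (Set.Icc (c - ρ) (c + ρ)) :=
      ContinuousOn.div (by fun_prop) (by fun_prop) fun y hy => (hpos y hy).ne'
    have h2 : ContinuousOn (fun y => (c * y - b ^ 2) / (ρ * y)) (Set.Icc (c - ρ) (c + ρ)) :=
      ContinuousOn.div (by fun_prop) (by fun_prop) fun y hy => (mul_pos hρ (hpos y hy)).ne'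
    have h3 : ContinuousOn (fun y => (y - c) / ρ) (Set.Icc (c - ρ) (c + ρ)) := by fun_prop
    exact (h1.neg.add (continuousOn_const.mul (continuous_arcsin.comp_continuousOn h2))).sub
      (continuous_arcsin.comp_continuousOn h3)
  have hderiv : ∀ y ∈ Set.Ioo (c - ρ) (c + ρ),
      HasDerivAt F (√(ρ ^ 2 - (y - c) ^ 2) / y ^ 2) y := by
    intro y hy
    have hy0 : 0 < y := hpos y (Set.Ioo_subset_Icc_self hy)
    have hD : 0 < ρ ^ 2 - (y - c) ^ 2 := by nlinarith [hy.1, hy.2]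
    set s := √(ρ ^ 2 - (y - c) ^ 2) with hs
    have hs0 : 0 < s := sqrt_pos.2 hD
    have hs2 : s ^ 2 = ρ ^ 2 - (y - c) ^ 2 := sq_sqrt hD.le
    have e1 : √(1 - ((y - c) / ρ) ^ 2) = s / ρ := by
      rw [← sqrt_sq (div_pos hs0 hρ).le, div_pow s, hs2]
      congr 1
      field_simp
    have e2 : √(1 - ((c * y - b ^ 2) / (ρ * y)) ^ 2) = b * s / (ρ * y) := by
      rw [← sqrt_sq (div_pos (mul_pos hb hs0) (mul_pos hρ hy0)).le, div_pow (b * s), mul_pow b, hs2]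
      congr 1
      field_simp
      have : ρ ^ 2 = c ^ 2 - b ^ 2 := by linarith
      rw [this]
      ring
    have p1 : 0 < 1 - ((y - c) / ρ) ^ 2 := sqrt_pos.1 (e1 ▸ div_pos hs0 hρ)
    have p2 : 0 < 1 - ((c * y - b ^ 2) / (ρ * y)) ^ 2 :=
      sqrt_pos.1 (e2 ▸ div_pos (mul_pos hb hs0) (mul_pos hρ hy0))
    have d1 : HasDerivAt (fun y => √(ρ ^ 2 - (y - c) ^ 2)) (-(2 * (y - c)) / (2 * s)) y := by
      have := ((((hasDerivAt_id y).sub_const c).pow 2).const_sub (ρ ^ 2)).sqrt hD.ne'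
      refine this.congr_deriv ?_
      simp [hs]
    have d2 : HasDerivAt (fun y => arcsin ((y - c) / ρ)) (1 / (s / ρ) * (1 / ρ)) y := by
      rw [← e1]
      exact (hasDerivAt_arcsin (by nlinarith) (by nlinarith)).comp y
        (((hasDerivAt_id y).sub_const c).div_const ρ)
    have d3 : HasDerivAt (fun y => arcsin ((c * y - b ^ 2) / (ρ * y)))
        (1 / (b * s / (ρ * y)) *
          ((c * 1 * (ρ * y) - (c * y - b ^ 2) * (ρ * 1)) / (ρ * y) ^ 2)) y := by
      rw [← e2]
      exact (hasDerivAt_arcsin (by nlinarith) (by nlinarith)).comp y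
        ((((hasDerivAt_id y).const_mul c).sub_const (b ^ 2)).div
          ((hasDerivAt_id y).const_mul ρ) (mul_pos hρ hy0).ne')
    refine (((d1.div (hasDerivAt_id y) hy0.ne').neg.add (d3.const_mul (c / b))).sub
      d2).congr_deriv ?_
    simp only [id, ← hs]
    field_simp
    rw [hs2]
    ring
  have hint : IntervalIntegrable (fun y => √(ρ ^ 2 - (y - c) ^ 2) / y ^ 2) volume
      (c - ρ) (c + ρ) := by
    apply ContinuousOn.intervalIntegrable_of_Icc hle
    exact ContinuousOn.div (by fun_prop) (by fun_prop) fun y hy => (pow_pos (hpos y hy) 2).ne'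
  rw [intervalIntegral.integral_eq_sub_of_hasDerivAt_of_le hle hcont hderiv hint]
  have hb2 : b ^ 2 = (c - ρ) * (c + ρ) := by linarith
  have v1 : (c * (c + ρ) - b ^ 2) / (ρ * (c + ρ)) = 1 := by
    rw [hb2, div_eq_one_iff_eq (by positivity)]; ring
  have v2 : (c * (c - ρ) - b ^ 2) / (ρ * (c - ρ)) = -1 := by
    have : c - ρ ≠ 0 := by linarith
    rw [hb2, div_eq_iff (by positivity)]; ring
  simp only [hF, v1, v2]
  have w1 : (c + ρ - c) / ρ = 1 := by field_simp; ring
  have w2 : (c - ρ - c) / ρ = -1 := by field_simp; ring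
  rw [w1, w2]
  simp
  ring

open MeasureTheory Real in
/-- The integral of `1 / y²` over a Euclidean disc contained in the upper half-plane. -/
theorem lintegral_ball_inv_im_sq {b ρ : ℝ} {p : ℂ} (hb : 0 < b) (hρ : 0 < ρ) (hc : 0 < p.im)
    (h : p.im ^ 2 = ρ ^ 2 + b ^ 2) :
    ∫⁻ z : ℂ in Metric.ball p ρ, ↑((1 / ‖z.im‖₊) ^ 2 : NNReal) =
      ENNReal.ofReal (2 * π * (p.im / b - 1)) := by
  have hcρ : ρ < p.im := by nlinarith [sq_nonneg (p.im - ρ), sq_pos_of_pos hb]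
  rw [← lintegral_indicator measurableSet_ball,
    ← (Complex.volume_preserving_equiv_real_prod.symm).lintegral_comp_emb
      (MeasurableEquiv.measurableEmbedding _), Measure.volume_eq_prod,
    lintegral_prod_symm _ (by
      refine Measurable.aemeasurable ?_
      refine Measurable.comp (Measurable.indicator ?_ measurableSet_ball)
        (MeasurableEquiv.measurable _)
      fun_prop)]
  have inner_eq : ∀ y : ℝ, ∫⁻ x : ℝ, (Metric.ball p ρ).indicator
      (fun z : ℂ => (((1 / ‖z.im‖₊) ^ 2 : NNReal) : ENNReal))
        (Complex.measurableEquivRealProd.symm (x, y)) =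
      (Set.Icc (p.im - ρ) (p.im + ρ)).indicator
        (fun y => ENNReal.ofReal (2 * (√(ρ ^ 2 - (y - p.im) ^ 2) / y ^ 2))) y := by
    intro y
    set s := √(ρ ^ 2 - (y - p.im) ^ 2) with hs
    have key : ∀ x : ℝ, (Metric.ball p ρ).indicator
        (fun z : ℂ => (((1 / ‖z.im‖₊) ^ 2 : NNReal) : ENNReal))
          (Complex.measurableEquivRealProd.symm (x, y)) =
        (Set.Ioo (p.re - s) (p.re + s)).indicator
          (fun _ => ENNReal.ofReal (1 / y ^ 2)) x := by
      intro x
      have hval : (((1 / ‖y‖₊) ^ 2 : NNReal) : ENNReal) = ENNReal.ofReal (1 / y ^ 2) := by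
        rw [← ENNReal.ofReal_coe_nnreal]
        congr 1
        simp
      have hmem : Complex.measurableEquivRealProd.symm (x, y) ∈ Metric.ball p ρ ↔
          x ∈ Set.Ioo (p.re - s) (p.re + s) := by
        rw [Metric.mem_ball, Complex.dist_eq_re_im, Real.sqrt_lt' hρ]
        have : x ∈ Set.Ioo (p.re - s) (p.re + s) ↔ |x - p.re| < s := by
          rw [abs_lt, Set.mem_Ioo]
          constructor <;> rintro ⟨_, _⟩ <;> constructor <;> linarith
        rw [this, hs, Real.lt_sqrt (abs_nonneg _), sq_abs]
        change (x - p.re) ^ 2 + (y - p.im) ^ 2 < ρ ^ 2 ↔ _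
        constructor <;> intro _ <;> linarith
      by_cases hx : x ∈ Set.Ioo (p.re - s) (p.re + s)
      · rw [Set.indicator_of_mem hx, Set.indicator_of_mem (hmem.2 hx), ← hval]
        rfl
      · rw [Set.indicator_of_notMem hx, Set.indicator_of_notMem (mt hmem.1 hx)]
    simp_rw [key]
    rw [lintegral_indicator_const measurableSet_Ioo, Real.volume_Ioo,
      ← ENNReal.ofReal_mul (by positivity)]
    have hval : 1 / y ^ 2 * (p.re + s - (p.re - s)) = 2 * (s / y ^ 2) := by ring
    rw [hval]
    by_cases hy : y ∈ Set.Icc (p.im - ρ) (p.im + ρ)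
    · rw [Set.indicator_of_mem hy]
    · have : s = 0 := by
        apply Real.sqrt_eq_zero_of_nonpos
        by_contra! hneg
        have := abs_lt_of_sq_lt_sq (by linarith : (y - p.im) ^ 2 < ρ ^ 2) hρ.le
        rw [abs_lt] at this
        exact hy ⟨by linarith [this.1], by linarith [this.2]⟩
      rw [Set.indicator_of_notMem hy, this]
      simp
  simp_rw [inner_eq]
  have hcont : ContinuousOn (fun y => 2 * (√(ρ ^ 2 - (y - p.im) ^ 2) / y ^ 2))
      (Set.Icc (p.im - ρ) (p.im + ρ)) :=
    continuousOn_const.mul <| ContinuousOn.div (by fun_prop) (by fun_prop) fun y hy =>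
      (pow_pos (by linarith [hy.1] : 0 < y) 2).ne'
  rw [lintegral_indicator measurableSet_Icc,
    ← ofReal_integral_eq_lintegral_ofReal (hcont.integrableOn_Icc)
      (Filter.Eventually.of_forall fun y => by positivity), integral_Icc_eq_integral_Ioc,
    ← intervalIntegral.integral_of_le (by linarith), intervalIntegral.integral_const_mul,
    integral_sqrt_sub_sq_div_sq hb hρ hc h, mul_assoc]

open MeasureTheory in
/-- The hyperbolic area of a disc of radius `R` is `4π sinh²(R/2)`. -/
theorem UpperHalfPlane.volume_ball (z : ℍ) {R : ℝ} (hR : 0 < R) :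
    volume (Metric.ball z R) = ENNReal.ofReal (4 * Real.pi * Real.sinh (R / 2) ^ 2) := by
  rw [volume_eq_lintegral, image_coe_ball,
    lintegral_ball_inv_im_sq z.im_pos (mul_pos z.im_pos (Real.sinh_pos_iff.2 hR))
      (center z R).im_pos]
  · congr 1
    rw [coe_im, center_im, mul_div_cancel_left₀ _ z.im_ne_zero]
    have h := Real.cosh_two_mul (R / 2)
    rw [Real.cosh_sq, mul_div_cancel₀ R two_ne_zero] at h
    rw [h]
    ring
  · rw [coe_im, center_im, mul_pow, Real.cosh_sq]
    ring

open MeasureTheory in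
/-- Packing bound for finite `2r`-separated subsets of a hyperbolic annulus. -/
theorem separated_finset_annulus_card_bound {r : ℝ} (hr : 0 < r) (t : Finset ℍ)
    (hsep : ∀ w ∈ t, ∀ w' ∈ t, w ≠ w' → 2 * r ≤ dist w w')
    (z : ℍ) {u T₀ : ℝ} (hu : T₀ < u) (hT₀ : r < T₀)
    (ht : ∀ w ∈ t, T₀ ≤ dist z w ∧ dist z w < u) :
    (t.card : ℝ) ≤ (Real.sinh ((u + r) / 2) ^ 2 - Real.sinh ((T₀ - r) / 2) ^ 2) /
      Real.sinh (r / 2) ^ 2 := by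
  have hdisj : (t : Set ℍ).PairwiseDisjoint fun w => Metric.ball w r := fun w hw w' hw' hne =>
    Metric.ball_disjoint_ball (by linarith [hsep w hw w' hw' hne])
  have hunion : volume (⋃ w ∈ t, Metric.ball w r) =
      t.card * ENNReal.ofReal (4 * Real.pi * Real.sinh (r / 2) ^ 2) := by
    rw [measure_biUnion_finset hdisj fun _ _ => measurableSet_ball]
    simp [volume_ball _ hr]
  have hinner : Disjoint (Metric.ball z (T₀ - r)) (⋃ w ∈ t, Metric.ball w r) := by
    simp only [Set.disjoint_iUnion_right]
    exact fun w hw => Metric.ball_disjoint_ball (by linarith [(ht w hw).1])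
  have hsub : Metric.ball z (T₀ - r) ∪ (⋃ w ∈ t, Metric.ball w r) ⊆ Metric.ball z (u + r) := by
    refine Set.union_subset (Metric.ball_subset_ball (by linarith)) (Set.iUnion₂_subset ?_)
    intro w hw
    refine Metric.ball_subset_ball' ?_
    rw [dist_comm]
    linarith [(ht w hw).2]
  have hle := measure_mono (μ := volume) hsub
  rw [measure_union hinner (Finset.measurableSet_biUnion _ fun _ _ => measurableSet_ball), hunion,
    volume_ball _ (by linarith), volume_ball _ (by linarith), ← ENNReal.ofReal_natCast,
    ← ENNReal.ofReal_mul (by positivity), ← ENNReal.ofReal_add (by positivity) (by positivity),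
    ENNReal.ofReal_le_ofReal_iff (by positivity)] at hle
  have hs : 0 < Real.sinh (r / 2) := Real.sinh_pos_iff.2 (by linarith)
  rw [le_div_iff₀ (by positivity)]
  refine le_of_mul_le_mul_left ?_ (by positivity : 0 < 4 * Real.pi)
  linarith

/-- A `2r`-separated set of points in the hyperbolic upper half-plane has at most
`(sinh²((u+r)/2) − sinh²((T₀−r)/2)) / sinh²(r/2)` points at hyperbolic distance in `[T₀, u)`
from any point `z`, whenever `u > T₀ > r > 0`. -/
theorem separated_set_annulus_card_bound
    (r : ℝ) (hr : 0 < r) (S : Set ℍ)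
    (hsep : ∀ w ∈ S, ∀ w' ∈ S, w ≠ w' → 2 * r ≤ dist w w')
    (z : ℍ) (u T₀ : ℝ) (hu : T₀ < u) (hT₀ : r < T₀) :
    {w ∈ S | T₀ ≤ dist z w ∧ dist z w < u}.Finite ∧
      ({w ∈ S | T₀ ≤ dist z w ∧ dist z w < u}.ncard : ℝ) ≤
        (Real.sinh ((u + r) / 2) ^ 2 - Real.sinh ((T₀ - r) / 2) ^ 2) /
          Real.sinh (r / 2) ^ 2 := by
  have key : ∀ t : Finset ℍ, (t : Set ℍ) ⊆ {w ∈ S | T₀ ≤ dist z w ∧ dist z w < u} →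
      (t.card : ℝ) ≤ (Real.sinh ((u + r) / 2) ^ 2 - Real.sinh ((T₀ - r) / 2) ^ 2) /
        Real.sinh (r / 2) ^ 2 := fun t ht =>
    separated_finset_annulus_card_bound hr t
      (fun w hw w' hw' => hsep w (ht hw).1 w' (ht hw').1) z hu hT₀ fun w hw => (ht hw).2
  have hfin : {w ∈ S | T₀ ≤ dist z w ∧ dist z w < u}.Finite := by
    by_contra hinf
    obtain ⟨n, hn⟩ := exists_nat_gt
      ((Real.sinh ((u + r) / 2) ^ 2 - Real.sinh ((T₀ - r) / 2) ^ 2) / Real.sinh (r / 2) ^ 2)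
    obtain ⟨t, ht, rfl⟩ := Set.Infinite.exists_subset_card_eq hinf n
    exact (key t ht).not_gt hn
  refine ⟨hfin, ?_⟩
  rw [Set.ncard_eq_toFinset_card _ hfin]
  exact key _ (by simp)
end

section
/- For every z ∈ ℍ and every r > 0, the hyperbolic area of the open hyperbolic metric ball of radius r centered at z equals 4π·sinh²(r/2). -/
open UpperHalfPlane MeasureTheory

/-- The hyperbolic area measure on the upper half-plane, viewed as the measure on `ℂ`
with density `1 / (Im z)²` with respect to Lebesgue measure. -/
noncomputable def hyperbolicAreaMeasure : Measure ℂ :=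
  volume.withDensity fun z : ℂ => ENNReal.ofReal (1 / z.im ^ 2)

/-- The integral over `y` of the lengths of the horizontal chords of the Euclidean disc of radius `R`
whose center has height `c`, weighted by `1 / y ^ 2`. -/
theorem integral_chord_length_div_sq {a c R : ℝ} (ha : 0 < a) (hR : 0 < R) (hc : R < c)
    (h : c ^ 2 = R ^ 2 + a ^ 2) :
    ∫ y in (c - R)..(c + R), 2 * √(R ^ 2 - (y - c) ^ 2) / y ^ 2 =
      2 * Real.pi * (c / a - 1) := by
  have hpos : ∀ y ∈ Set.Icc (c - R) (c + R), 0 < y := fun y hy => by linarith [hy.1]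
  have hderiv : ∀ y ∈ Set.Ioo (c - R) (c + R), HasDerivAt
      (fun y => -(2 * √(R ^ 2 - (y - c) ^ 2) / y) +
        2 * (c / a) * Real.arcsin (c / R - a ^ 2 / R / y) - 2 * Real.arcsin ((y - c) / R))
      (2 * √(R ^ 2 - (y - c) ^ 2) / y ^ 2) y := by
    intro y hy
    have hy0 : 0 < y := hpos y (Set.Ioo_subset_Icc_self hy)
    have hq : 0 < R ^ 2 - (y - c) ^ 2 := by nlinarith [hy.1, hy.2]
    have hs : 0 < √(R ^ 2 - (y - c) ^ 2) := Real.sqrt_pos.2 hq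
    have hs2 : √(R ^ 2 - (y - c) ^ 2) ^ 2 = R ^ 2 - (y - c) ^ 2 := Real.sq_sqrt hq.le
    have h1 : 1 - (c / R - a ^ 2 / R / y) ^ 2 =
        (a * √(R ^ 2 - (y - c) ^ 2) / (R * y)) ^ 2 := by
      rw [div_pow, mul_pow, hs2]
      field_simp
      linear_combination (a ^ 2 - y ^ 2) * h
    have h2 : 1 - ((y - c) / R) ^ 2 = (√(R ^ 2 - (y - c) ^ 2) / R) ^ 2 := by
      rw [div_pow, div_pow, hs2]
      field_simp
    have hsq : HasDerivAt (fun y => √(R ^ 2 - (y - c) ^ 2))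
        (-(y - c) / √(R ^ 2 - (y - c) ^ 2)) y := by
      convert! ((((hasDerivAt_id y).sub_const c).pow 2).const_sub (R ^ 2)).sqrt hq.ne' using 1
      simp
      field_simp
      ring
    have hu : HasDerivAt (fun y => c / R - a ^ 2 / R / y) (a ^ 2 / R / y ^ 2) y := by
      convert! ((hasDerivAt_const y (a ^ 2 / R)).div (hasDerivAt_id y) hy0.ne').const_sub (c / R)
        using 1
      simp
      field_simp
    have hv : HasDerivAt (fun y => (y - c) / R) (1 / R) y :=
      ((hasDerivAt_id y).sub_const c).div_const R
    have hne : ∀ x t : ℝ, 0 < t → 1 - x ^ 2 = t ^ 2 → x ≠ -1 ∧ x ≠ 1 := by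
      rintro x t ht hx
      constructor <;> rintro rfl <;> nlinarith
    have hu1 := hne _ _ (by positivity) h1
    have hv1 := hne _ _ (by positivity) h2
    have hU := (Real.hasDerivAt_arcsin hu1.1 hu1.2).comp y hu
    have hV := (Real.hasDerivAt_arcsin hv1.1 hv1.2).comp y hv
    rw [h1, Real.sqrt_sq (by positivity)] at hU
    rw [h2, Real.sqrt_sq (by positivity)] at hV
    convert! (((hsq.const_mul 2).div (hasDerivAt_id y) hy0.ne').neg.add
      (hU.const_mul (2 * (c / a)))).sub (hV.const_mul 2) using 1
    simp only [id]
    generalize √(R ^ 2 - (y - c) ^ 2) = s at *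
    field_simp
    ring_nf
  rw [intervalIntegral.integral_eq_sub_of_hasDerivAt_of_le (by linarith) _ hderiv]
  · have e1 : c / R - a ^ 2 / R / (c + R) = 1 := by
      have : c + R ≠ 0 := by linarith
      field_simp
      linear_combination h
    have e2 : c / R - a ^ 2 / R / (c - R) = -1 := by
      have : c - R ≠ 0 := by linarith
      field_simp
      linear_combination h
    have e3 : (c + R - c) / R = 1 := by field_simp; ring
    have e4 : (c - R - c) / R = -1 := by field_simp; ring
    rw [e1, e2, e3, e4]
    simp
    ring
  · refine ContinuousOn.intervalIntegrable_of_Icc (by linarith) ?_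
    refine ContinuousOn.div (by fun_prop) (by fun_prop) fun y hy => (pow_pos (hpos y hy) 2).ne'
  · have hne : ∀ y ∈ Set.Icc (c - R) (c + R), y ≠ 0 := fun y hy => (hpos y hy).ne'
    refine ((ContinuousOn.div (by fun_prop) (by fun_prop) hne).neg.add
      (continuousOn_const.mul (Real.continuous_arcsin.comp_continuousOn
        (continuousOn_const.sub (continuousOn_const.div continuousOn_id hne))))).sub ?_
    exact (continuous_const.mul (Real.continuous_arcsin.comp (by fun_prop))).continuousOn

/-- The horizontal slices of a Euclidean disc in `ℂ`. -/
theorem volume_slice_complex_ball (w : ℂ) {R : ℝ} (hR : 0 < R) (y : ℝ) :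
    volume {x : ℝ | (⟨x, y⟩ : ℂ) ∈ Metric.ball w R} =
      ENNReal.ofReal (2 * √(R ^ 2 - (y - w.im) ^ 2)) := by
  have : {x : ℝ | (⟨x, y⟩ : ℂ) ∈ Metric.ball w R} =
      Set.Ioo (w.re - √(R ^ 2 - (y - w.im) ^ 2)) (w.re + √(R ^ 2 - (y - w.im) ^ 2)) := by
    ext x
    have := Real.sq_lt (x := x - w.re) (y := R ^ 2 - (y - w.im) ^ 2)
    rw [Set.mem_ofPred_eq, Metric.mem_ball, Complex.dist_eq_re_im, Real.sqrt_lt' hR, Set.mem_Ioo,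
      ← lt_sub_iff_add_lt, this]
    constructor <;> rintro ⟨h₁, h₂⟩ <;> constructor <;> linarith
  rw [this, Real.volume_Ioo]
  ring_nf

/-- The hyperbolic area of a Euclidean disc as an integral over the heights of its points. -/
theorem hyperbolicAreaMeasure_ball_eq_lintegral (w : ℂ) {R : ℝ} (hR : 0 < R) :
    hyperbolicAreaMeasure (Metric.ball w R) =
      ∫⁻ y : ℝ, ENNReal.ofReal (2 * √(R ^ 2 - (y - w.im) ^ 2) / y ^ 2) := by
  have hf : Measurable fun z : ℂ => ENNReal.ofReal (1 / z.im ^ 2) := by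
    have := Complex.measurable_im
    fun_prop
  rw [hyperbolicAreaMeasure, withDensity_apply _ measurableSet_ball,
    ← lintegral_indicator measurableSet_ball,
    ← Complex.volume_preserving_equiv_real_prod.symm.lintegral_comp
      (hf.indicator measurableSet_ball), Measure.volume_eq_prod, lintegral_prod_symm']
  · refine lintegral_congr fun y => ?_
    have hs : MeasurableSet {x : ℝ | (⟨x, y⟩ : ℂ) ∈ Metric.ball w R} :=
      (Complex.measurableEquivRealProd.symm.measurable.comp measurable_prodMk_right)
        measurableSet_ball
    have : ∀ x : ℝ, (Metric.ball w R).indicator (fun z : ℂ => ENNReal.ofReal (1 / z.im ^ 2))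
        (Complex.measurableEquivRealProd.symm (x, y)) =
        {x : ℝ | (⟨x, y⟩ : ℂ) ∈ Metric.ball w R}.indicator
          (fun _ => ENNReal.ofReal (1 / y ^ 2)) x := fun x => rfl
    simp_rw [this]
    rw [lintegral_indicator_const hs, volume_slice_complex_ball w hR,
      ← ENNReal.ofReal_mul (by positivity)]
    ring_nf
  · exact (hf.indicator measurableSet_ball).comp Complex.measurableEquivRealProd.symm.measurable

/-- The hyperbolic area of a Euclidean disc contained in the upper half-plane. -/
theorem hyperbolicAreaMeasure_ball (w : ℂ) {a R : ℝ} (ha : 0 < a) (hR : 0 < R) (hw : R < w.im)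
    (h : w.im ^ 2 = R ^ 2 + a ^ 2) :
    hyperbolicAreaMeasure (Metric.ball w R) =
      ENNReal.ofReal (2 * Real.pi * (w.im / a - 1)) := by
  rw [hyperbolicAreaMeasure_ball_eq_lintegral w hR, ← integral_chord_length_div_sq ha hR hw h,
    intervalIntegral.integral_of_le (by linarith), ofReal_integral_eq_lintegral_ofReal,
    ← lintegral_indicator measurableSet_Ioc]
  · refine lintegral_congr fun y => ?_
    by_cases hy : y ∈ Set.Ioc (w.im - R) (w.im + R)
    · rw [Set.indicator_of_mem hy]
    · have : R ^ 2 - (y - w.im) ^ 2 ≤ 0 := by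
        rw [Set.mem_Ioc, not_and_or, not_lt, not_le] at hy
        rcases hy with hy | hy <;> nlinarith
      rw [Set.indicator_of_notMem hy, Real.sqrt_eq_zero_of_nonpos this]
      simp
  · refine (ContinuousOn.integrableOn_Icc ?_).mono_set Set.Ioc_subset_Icc_self
    refine ContinuousOn.div (by fun_prop) (by fun_prop) fun y hy => ?_
    have : 0 < y := by linarith [hy.1]
    positivity
  · exact Filter.Eventually.of_forall fun y => by positivity

/-- the hyperbolic area of the open hyperbolic ball of radius `r > 0`
centered at `z ∈ ℍ` equals `4π·sinh²(r/2)`. -/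
theorem hyperbolicArea_ball (z : ℍ) (r : ℝ) (hr : 0 < r) :
    hyperbolicAreaMeasure ((fun w : ℍ => (w : ℂ)) '' Metric.ball z r) =
      ENNReal.ofReal (4 * Real.pi * Real.sinh (r / 2) ^ 2) := by
  have hz := z.im_pos
  have him : (z.center r : ℂ).im = z.im * Real.cosh r := z.center_im r
  have hcosh : Real.cosh r = 2 * Real.sinh (r / 2) ^ 2 + 1 := by
    have h₁ := Real.cosh_two_mul (r / 2)
    have h₂ := Real.cosh_sq (r / 2)
    rw [mul_div_cancel₀ r two_ne_zero] at h₁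
    linarith
  rw [image_coe_ball, hyperbolicAreaMeasure_ball _ hz (mul_pos hz (Real.sinh_pos_iff.2 hr)), him,
    mul_div_cancel_left₀ _ hz.ne', hcosh]
  · ring_nf
  · rw [him]
    exact mul_lt_mul_of_pos_left (Real.sinh_lt_cosh r) hz
  · rw [him, mul_pow, Real.cosh_sq]
    ring
end

section
/- Let ℓ > 0 and θ₀ ∈ (0, π/2). The length, with respect to the hyperbolic metric on ℍ, of the curve t ↦ e^t·e^{iθ₀} for t ∈ [0, ℓ] equals ℓ / sin θ₀; equivalently, setting ε = 2ℓ·cot θ₀, this length equals √(ℓ² + ε²/4). (Concretely, the total variation of the map t ↦ e^t·e^{iθ₀} from [0, ℓ] into the metric space ℍ equals ℓ / sin θ₀.) -/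
open UpperHalfPlane

open Filter Topology in
/-- The sums `n * g (x / n)` converge to `x` times the derivative of `g` at `0`. -/
theorem HasDerivAt.tendsto_natCast_mul_div {g : ℝ → ℝ} {k : ℝ} (hg : HasDerivAt g k 0)
    (h0 : g 0 = 0) (x : ℝ) :
    Tendsto (fun n : ℕ => (n : ℝ) * g (x / n)) atTop (𝓝 (k * x)) := by
  have hd : HasDerivAt (fun y => g (x * y)) (k * x) 0 := by
    have hlin : HasDerivAt (fun y : ℝ => x * y) x 0 := by
      simpa using (hasDerivAt_id (0 : ℝ)).const_mul x
    exact HasDerivAt.comp (h₂ := g) 0 (by simpa using hg) hlin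
  have hseq : Tendsto (fun n : ℕ => ((n : ℝ))⁻¹) atTop (𝓝[≠] 0) := by
    refine tendsto_nhdsWithin_iff.2 ⟨tendsto_inv_atTop_nhds_zero_nat, ?_⟩
    filter_upwards [eventually_gt_atTop 0] with n hn
    simpa using hn.ne'
  refine ((hasDerivAt_iff_tendsto_slope.1 hd).comp hseq).congr fun n => ?_
  simp [slope_def_field, h0, div_eq_mul_inv, mul_comm]

/-- A curve along which the distance is a function `g` of the parameter difference has constant
speed equal to the derivative of `g` at `0`. -/
theorem eVariationOn_Icc_eq_of_dist_eq {E : Type*} [PseudoMetricSpace E] {f : ℝ → E} {g : ℝ → ℝ}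
    {k : NNReal} (hf : ∀ s t, s ≤ t → dist (f s) (f t) = g (t - s)) (hg : HasDerivAt g k 0)
    {a b : ℝ} (hab : a ≤ b) :
    eVariationOn f (Set.Icc a b) = ENNReal.ofReal (k * (b - a)) := by
  have h0 : g 0 = 0 := by simpa using (hf 0 0 le_rfl).symm
  have hstep (s t : ℝ) (hst : s ≤ t) (n i : ℕ) :
      dist (f (s + i * ((t - s) / n))) (f (s + (i + 1 : ℕ) * ((t - s) / n))) =
        g ((t - s) / n) := by
    have hn : 0 ≤ (t - s) / n := div_nonneg (sub_nonneg.2 hst) n.cast_nonneg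
    rw [hf _ _ (by push_cast; linarith)]
    congr 1
    push_cast
    ring
  have hle (s t : ℝ) (hst : s ≤ t) : dist (f s) (f t) ≤ k * (t - s) := by
    refine ge_of_tendsto (hg.tendsto_natCast_mul_div h0 (t - s)) ?_
    filter_upwards [Filter.eventually_gt_atTop 0] with n hn
    have hn' : (n : ℝ) ≠ 0 := by exact_mod_cast hn.ne'
    have hsum := dist_le_range_sum_dist (fun i : ℕ => f (s + i * ((t - s) / n))) n
    simp only [hstep s t hst n, Finset.sum_const, Finset.card_range, nsmul_eq_mul] at hsum
    simpa [mul_div_cancel₀ _ hn'] using hsum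
  have hlip : LipschitzWith k f := LipschitzWith.of_dist_le_mul fun s t => by
    rcases le_total s t with h | h
    · rw [Real.dist_eq, abs_sub_comm, abs_of_nonneg (sub_nonneg.2 h)]
      exact hle s t h
    · rw [Real.dist_eq, dist_comm, abs_of_nonneg (sub_nonneg.2 h)]
      exact hle t s h
  apply le_antisymm
  · calc eVariationOn f (Set.Icc a b) ≤ k * eVariationOn id (Set.Icc a b) :=
          hlip.lipschitzOnWith.comp_eVariationOn_le (Set.mapsTo_univ id (Set.Icc a b))
      _ ≤ k * ENNReal.ofReal (b - a) := by
          gcongr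
          simp
      _ = ENNReal.ofReal (k * (b - a)) := by
          rw [ENNReal.ofReal_mul k.coe_nonneg, ENNReal.ofReal_coe_nnreal]
  · refine le_of_tendsto
      (ENNReal.tendsto_ofReal (hg.tendsto_natCast_mul_div h0 (b - a))) ?_
    filter_upwards [Filter.eventually_gt_atTop 0] with n hn
    have hn' : (0 : ℝ) < n := by exact_mod_cast hn
    have hd : 0 ≤ (b - a) / n := div_nonneg (sub_nonneg.2 hab) hn'.le
    have hsum := eVariationOn.sum_le_of_monotoneOn_Icc (f := f) (s := Set.Icc a b) (m := 0)
      (n := n) (u := fun i : ℕ => a + i * ((b - a) / n))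
      (fun i _ j _ hij => by dsimp only; gcongr)
      (fun i hi => by
        have hi' : (i : ℝ) ≤ n := by exact_mod_cast hi.2
        refine ⟨le_add_of_nonneg_right (by positivity), ?_⟩
        calc a + i * ((b - a) / n) ≤ a + n * ((b - a) / n) := by gcongr
          _ = b := by rw [mul_div_cancel₀ _ hn'.ne']; ring)
    refine le_of_eq_of_le ?_ hsum
    simp only [edist_comm (f (a + (_ + 1 : ℕ) * _)), edist_dist, hstep a b hab n,
      Finset.sum_const, Nat.Ico_zero_eq_range, Finset.card_range, nsmul_eq_mul]
    rw [ENNReal.ofReal_mul hn'.le, ENNReal.ofReal_natCast]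

/-- The hyperbolic distance between points on a ray from the origin, in polar coordinates. -/
theorem UpperHalfPlane.dist_mk_exp_mul {c r s t : ℝ} (hr : 0 < r) (hcr : c ^ 2 + r ^ 2 = 1)
    (hst : s ≤ t) :
    dist (⟨⟨Real.exp s * c, Real.exp s * r⟩, mul_pos (Real.exp_pos s) hr⟩ : ℍ)
        ⟨⟨Real.exp t * c, Real.exp t * r⟩, mul_pos (Real.exp_pos t) hr⟩ =
      2 * Real.arsinh (Real.sinh ((t - s) / 2) / r) := by
  have hs : Real.exp s = Real.exp (s / 2) ^ 2 := by
    rw [← Real.exp_nat_mul]; congr 1; push_cast; ring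
  have ht : Real.exp t = Real.exp (t / 2) ^ 2 := by
    rw [← Real.exp_nat_mul]; congr 1; push_cast; ring
  have hsinh : Real.sinh ((t - s) / 2) =
      (Real.exp t - Real.exp s) / (2 * (Real.exp (s / 2) * Real.exp (t / 2))) := by
    rw [Real.sinh_eq, show -((t - s) / 2) = s / 2 - t / 2 by ring,
      show (t - s) / 2 = t / 2 - s / 2 by ring, Real.exp_sub, Real.exp_sub, hs, ht]
    field_simp
  rw [UpperHalfPlane.dist_eq, hsinh, Complex.dist_eq_re_im]
  congr 2
  change √((Real.exp s * c - Real.exp t * c) ^ 2 + (Real.exp s * r - Real.exp t * r) ^ 2) /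
    (2 * √(Real.exp s * r * (Real.exp t * r))) = _
  have hnum : (Real.exp s * c - Real.exp t * c) ^ 2 + (Real.exp s * r - Real.exp t * r) ^ 2 =
      (Real.exp t - Real.exp s) ^ 2 := by
    linear_combination (Real.exp t - Real.exp s) ^ 2 * hcr
  have hden : Real.exp s * r * (Real.exp t * r) =
      (Real.exp (s / 2) * Real.exp (t / 2) * r) ^ 2 := by
    rw [hs, ht]; ring
  rw [hnum, hden, Real.sqrt_sq (sub_nonneg.2 (Real.exp_le_exp.2 hst)),
    Real.sqrt_sq (by positivity), div_div]
  ring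

/-- for `ℓ > 0` and `θ₀ ∈ (0, π/2)`, the hyperbolic length (total variation)
of the curve `t ↦ e^t·e^{iθ₀}`, `t ∈ [0, ℓ]`, in the upper half-plane equals `ℓ / sin θ₀`;
equivalently, setting `ε = 2ℓ·cot θ₀`, it equals `√(ℓ² + ε²/4)`. -/
theorem length_subcylinder_boundary (ℓ θ₀ : ℝ) (hℓ : 0 < ℓ)
    (hθ₀ : θ₀ ∈ Set.Ioo 0 (Real.pi / 2)) :
    eVariationOn
        (fun t : ℝ =>
          (⟨⟨Real.exp t * Real.cos θ₀, Real.exp t * Real.sin θ₀⟩,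
            mul_pos (Real.exp_pos t)
              (Real.sin_pos_of_pos_of_lt_pi hθ₀.1
                (hθ₀.2.trans (half_lt_self Real.pi_pos)))⟩ : ℍ))
        (Set.Icc 0 ℓ) =
      ENNReal.ofReal (ℓ / Real.sin θ₀) ∧
    ℓ / Real.sin θ₀ =
      Real.sqrt (ℓ ^ 2 + (2 * ℓ * (Real.cos θ₀ / Real.sin θ₀)) ^ 2 / 4) := by
  have hsin : 0 < Real.sin θ₀ :=
    Real.sin_pos_of_pos_of_lt_pi hθ₀.1 (hθ₀.2.trans (half_lt_self Real.pi_pos))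
  constructor
  · have hk : ((Real.sin θ₀)⁻¹.toNNReal : ℝ) = (Real.sin θ₀)⁻¹ :=
      Real.coe_toNNReal _ (inv_pos.2 hsin).le
    have hg : HasDerivAt (fun x => 2 * Real.arsinh (Real.sinh (x / 2) / Real.sin θ₀))
        ((Real.sin θ₀)⁻¹.toNNReal : ℝ) 0 := by
      refine ((((hasDerivAt_id (0 : ℝ)).div_const 2).sinh.div_const
        (Real.sin θ₀)).arsinh.const_mul 2).congr_deriv ?_
      simp only [id, hk, zero_div, Real.sinh_zero, Real.cosh_zero]
      simp
      field_simp
    rw [eVariationOn_Icc_eq_of_dist_eq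
      (fun s t hst => UpperHalfPlane.dist_mk_exp_mul hsin (Real.cos_sq_add_sin_sq θ₀) hst)
      hg hℓ.le, hk, sub_zero, inv_mul_eq_div]
  · rw [eq_comm, Real.sqrt_eq_iff_mul_self_eq (by positivity) (by positivity)]
    field_simp
    linear_combination 4 * Real.sin_sq_add_cos_sq θ₀
end

section
/- Let r > 0 and let S be a set of points in ℍ that is 2r-separated, i.e. dist(w, w') ≥ 2r for all distinct w, w' ∈ S. Then for every z ∈ ℍ, every δ > 0, and every T₀ > r, the sum over all w ∈ S with dist(z, w) ≥ T₀ of (cosh(dist(z, w)))^{−(1+δ)} converges and satisfies Σ_{w ∈ S, dist(z,w) ≥ T₀} (cosh(dist(z, w)))^{−(1+δ)} ≤ e^{−δ·T₀}·( 2^δ e^r / (δ·sinh²(r/2)) + 2^δ·sinh(r) / sinh²(r/2) ). -/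
open UpperHalfPlane

open MeasureTheory Set in
/-- Fundamental theorem of calculus for the lower Lebesgue integral of a nonnegative derivative. -/
lemma lintegral_Ioo_ofReal_eq_sub {F F' : ℝ → ℝ} {a b : ℝ} (hab : a ≤ b)
    (hcont : ContinuousOn F (Icc a b)) (hderiv : ∀ x ∈ Ioo a b, HasDerivAt F (F' x) x)
    (hpos : ∀ x ∈ Ioo a b, 0 ≤ F' x) :
    ∫⁻ x in Ioo a b, ENNReal.ofReal (F' x) = ENNReal.ofReal (F b - F a) := by
  have hint : IntegrableOn F' (Ioc a b) :=
    intervalIntegral.integrableOn_deriv_of_nonneg hcont hderiv hpos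
  rw [← intervalIntegral.integral_eq_sub_of_hasDerivAt_of_le hab hcont hderiv
    ((intervalIntegrable_iff_integrableOn_Ioc_of_le hab).2 hint),
    intervalIntegral.integral_of_le hab, integral_Ioc_eq_integral_Ioo,
    ofReal_integral_eq_lintegral_ofReal (hint.mono_set Ioo_subset_Ioc_self)]
  exact (ae_restrict_iff' measurableSet_Ioo).2 (.of_forall hpos)

/-- A primitive of `x ↦ 2 √(s² - x²) / (1 + x²)` on `(-s, s)`, where `c² = 1 + s²`. -/
lemma hasDerivAt_arcsin_sub_arcsin {c s x : ℝ} (hs : 0 < s)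
    (hcs : c ^ 2 = 1 + s ^ 2) (hx : x ∈ Set.Ioo (-s) s) :
    HasDerivAt
      (fun x ↦ 2 * (c * Real.arcsin (c * x / (s * √(1 + x ^ 2))) - Real.arcsin (x / s)))
      (2 * √(s ^ 2 - x ^ 2) / (1 + x ^ 2)) x := by
  obtain ⟨q, hq, hqx⟩ : ∃ q, 0 < q ∧ q ^ 2 = 1 + x ^ 2 :=
    ⟨√(1 + x ^ 2), by positivity, Real.sq_sqrt (by positivity)⟩
  have hsx : 0 < s ^ 2 - x ^ 2 := by nlinarith [hx.1, hx.2]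
  obtain ⟨t, ht, htx⟩ : ∃ t, 0 < t ∧ t ^ 2 = s ^ 2 - x ^ 2 :=
    ⟨√(s ^ 2 - x ^ 2), by positivity, Real.sq_sqrt hsx.le⟩
  have hu : 1 - (c * x / (s * q)) ^ 2 = (t / (s * q)) ^ 2 := by
    field_simp
    linear_combination s ^ 2 * hqx - htx - x ^ 2 * hcs
  have hv : 1 - (x / s) ^ 2 = (t / s) ^ 2 := by
    field_simp
    linear_combination -htx
  have hu_pos : 0 < (t / (s * q)) ^ 2 := by positivity
  have hv_pos : 0 < (t / s) ^ 2 := by positivity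
  have hq_sqrt : √(1 + x ^ 2) = q := by rw [← hqx, Real.sqrt_sq hq.le]
  have ht_sqrt : √(s ^ 2 - x ^ 2) = t := by rw [← htx, Real.sqrt_sq ht.le]
  have h_sqrt : HasDerivAt (fun x : ℝ ↦ s * √(1 + x ^ 2)) (s * (x / q)) x := by
    have h := (((hasDerivAt_pow 2 x).const_add 1).sqrt (by positivity)).const_mul s
    refine h.congr_deriv ?_
    rw [hq_sqrt]
    field_simp
    simp
  have h_div : HasDerivAt (fun x : ℝ ↦ c * x / (s * √(1 + x ^ 2))) (c / (s * q ^ 3)) x := by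
    have h := ((hasDerivAt_id x).const_mul c).div h_sqrt (by positivity)
    refine h.congr_deriv ?_
    simp only [id, hq_sqrt]
    field_simp
    linear_combination c * hqx
  have h₁ := (Real.hasDerivAt_arcsin (x := c * x / (s * √(1 + x ^ 2)))
    (by rw [hq_sqrt]; intro h; rw [h] at hu; norm_num at hu; simp_all)
    (by rw [hq_sqrt]; intro h; rw [h] at hu; norm_num at hu; simp_all)).comp x h_div
  have h₂ := (Real.hasDerivAt_arcsin (x := x / s)
    (by intro h; rw [h] at hv; norm_num at hv; simp_all)
    (by intro h; rw [h] at hv; norm_num at hv; simp_all)).comp x ((hasDerivAt_id x).div_const s)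
  refine (((h₁.const_mul c).sub h₂).const_mul 2).congr_deriv ?_
  rw [hq_sqrt, hu, hv, ht_sqrt, Real.sqrt_sq (by positivity), Real.sqrt_sq (by positivity), ← hqx]
  field_simp
  linear_combination hcs - htx - hqx

open MeasureTheory Set in
/-- The integral of the vertical slice lengths of a hyperbolic disc centred at `I`. -/
lemma lintegral_two_mul_sqrt_div {c s : ℝ} (hc : 0 < c) (hs : 0 < s) (hcs : c ^ 2 = 1 + s ^ 2) :
    ∫⁻ x in Ioo (-s) s, ENNReal.ofReal (2 * √(s ^ 2 - x ^ 2) / (1 + x ^ 2)) =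
      ENNReal.ofReal (2 * Real.pi * (c - 1)) := by
  rw [lintegral_Ioo_ofReal_eq_sub (by linarith) ?_
    (fun x hx ↦ hasDerivAt_arcsin_sub_arcsin hs hcs hx) (fun x _ ↦ by positivity)]
  · have h₁ : c * s / (s * √(1 + s ^ 2)) = 1 := by
      rw [← hcs, Real.sqrt_sq hc.le]; field_simp
    have h₂ : c * -s / (s * √(1 + (-s) ^ 2)) = -1 := by
      rw [neg_sq, ← hcs, Real.sqrt_sq hc.le]; field_simp
    rw [h₁, h₂, neg_div, div_self hs.ne', Real.arcsin_neg_one, Real.arcsin_one]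
    congr 1
    ring
  · refine Continuous.continuousOn ?_
    have : ∀ x : ℝ, s * √(1 + x ^ 2) ≠ 0 := fun x ↦ by positivity
    fun_prop (disch := assumption)

open MeasureTheory Set in
lemma lintegral_Ioo_one_div_sq {a b : ℝ} (ha : 0 < a) (hab : a ≤ b) :
    ∫⁻ y in Ioo a b, ENNReal.ofReal (1 / y ^ 2) = ENNReal.ofReal (a⁻¹ - b⁻¹) := by
  rw [lintegral_Ioo_ofReal_eq_sub (F := fun y ↦ -y⁻¹) hab ?_ ?_ (fun y _ ↦ by positivity)]
  · congr 1; ring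
  · refine (continuousOn_inv₀.mono fun y hy ↦ ?_).neg
    exact (ha.trans_le hy.1).ne'
  · intro y hy
    refine (hasDerivAt_inv (ha.trans hy.1).ne').neg.congr_deriv ?_
    ring

open MeasureTheory Set in
lemma volume_ball_I {r : ℝ} (hr : 0 < r) :
    volume (Metric.ball UpperHalfPlane.I r) =
      ENNReal.ofReal (2 * Real.pi * (Real.cosh r - 1)) := by
  have hcs := Real.cosh_sq' r
  have hc := Real.cosh_pos r
  have hs := Real.sinh_pos_iff.2 hr
  set c := Real.cosh r
  set s := Real.sinh r
  let A : Set (ℝ × ℝ) := {p | p.1 ^ 2 + (p.2 - c) ^ 2 < s ^ 2}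
  have hA : MeasurableSet A := measurableSet_lt (by fun_prop) (by fun_prop)
  rw [volume_eq_lintegral, image_coe_ball, ← lintegral_indicator measurableSet_ball,
    ← Complex.volume_preserving_equiv_real_prod.symm.lintegral_comp_emb
      Complex.measurableEquivRealProd.symm.measurableEmbedding, Measure.volume_eq_prod,
    ← lintegral_two_mul_sqrt_div hc hs hcs, ← lintegral_indicator measurableSet_Ioo]
  have key : ∀ p : ℝ × ℝ, (Metric.ball (↑(UpperHalfPlane.I.center r) : ℂ)
      (UpperHalfPlane.I.im * Real.sinh r)).indicator
        (fun z : ℂ ↦ (((1 / ‖z.im‖₊) ^ 2 : NNReal) : ENNReal))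
        (Complex.measurableEquivRealProd.symm p) =
      A.indicator (fun p ↦ ENNReal.ofReal (1 / p.2 ^ 2)) p := by
    intro p
    have hmem : Complex.measurableEquivRealProd.symm p ∈
        Metric.ball (↑(UpperHalfPlane.I.center r) : ℂ) (UpperHalfPlane.I.im * Real.sinh r) ↔
        p ∈ A := by
      rw [Metric.mem_ball, Complex.dist_eq, ← sq_lt_sq₀ (norm_nonneg _)
          (mul_nonneg UpperHalfPlane.I.im_pos.le hs.le),
        Complex.sq_norm, Complex.normSq_apply]
      simp [A, Complex.measurableEquivRealProd_symm_apply, sq, c, s]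
    simp only [indicator, hmem]
    split_ifs
    · rw [ENNReal.ofReal, ENNReal.coe_inj]
      ext
      simp [Complex.measurableEquivRealProd_symm_apply, sq_nonneg]
    · rfl
  simp_rw [key]
  rw [lintegral_prod _ ((Measurable.indicator (by fun_prop) hA).aemeasurable)]
  refine lintegral_congr fun x ↦ ?_
  by_cases hx : x ∈ Ioo (-s) s
  · have hsx : 0 < s ^ 2 - x ^ 2 := by nlinarith [hx.1, hx.2]
    obtain ⟨t, ht, htx⟩ : ∃ t, 0 < t ∧ t ^ 2 = s ^ 2 - x ^ 2 :=
      ⟨√(s ^ 2 - x ^ 2), by positivity, Real.sq_sqrt hsx.le⟩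
    have htc : t < c := lt_of_pow_lt_pow_left₀ 2 hc.le (by nlinarith)
    have hslice : ∀ y, A.indicator (fun p ↦ ENNReal.ofReal (1 / p.2 ^ 2)) (x, y) =
        (Ioo (c - t) (c + t)).indicator (fun y ↦ ENNReal.ofReal (1 / y ^ 2)) y := by
      intro y
      have : (x, y) ∈ A ↔ y ∈ Ioo (c - t) (c + t) := by
        have : (x, y) ∈ A ↔ (y - c) ^ 2 < t ^ 2 := by
          simp only [A, mem_ofPred_eq, htx]
          constructor <;> intro h <;> linarith
        rw [this, sq_lt_sq, abs_of_pos ht, abs_lt, mem_Ioo]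
        constructor <;> rintro ⟨h₁, h₂⟩ <;> constructor <;> linarith
      simp only [indicator, this]
    simp_rw [hslice]
    rw [lintegral_indicator measurableSet_Ioo,
      lintegral_Ioo_one_div_sq (by linarith) (by linarith), indicator_of_mem hx, ← htx,
      Real.sqrt_sq ht.le]
    congr 1
    have h₁ : c - t ≠ 0 := by linarith
    have h₂ : c + t ≠ 0 := by linarith
    have h₃ : 1 + x ^ 2 = (c - t) * (c + t) := by linear_combination htx - hcs
    rw [h₃]
    field_simp
    ring
  · rw [indicator_of_notMem hx]
    have hslice : ∀ y, A.indicator (fun p ↦ ENNReal.ofReal (1 / p.2 ^ 2)) (x, y) = 0 := by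
      intro y
      refine indicator_of_notMem (fun h ↦ hx ?_) _
      have h' : x ^ 2 < s ^ 2 := lt_of_le_of_lt (by nlinarith [sq_nonneg (y - c)]) h
      exact abs_lt.1 (abs_lt_of_sq_lt_sq h' hs.le)
    simp_rw [hslice, lintegral_zero]

open MeasureTheory Set in
/-- The area of a hyperbolic disc. -/
lemma volume_hyperbolic_ball (z : ℍ) {r : ℝ} (hr : 0 < r) :
    volume (Metric.ball z r) = ENNReal.ofReal (2 * Real.pi * (Real.cosh r - 1)) := by
  obtain ⟨g, rfl⟩ :=
    MulAction.exists_smul_eq (Matrix.SpecialLinearGroup (Fin 2) ℝ) UpperHalfPlane.I z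
  rw [← Metric.smul_ball, ← volume_ball_I hr]
  exact measure_smul volume (g : GL (Fin 2) ℝ) _

open MeasureTheory Set in
/-- A packing bound for the points of a `2r`-separated set at distance between `T` and `t`
from `z`. -/
lemma card_separated_mul_le {r t T : ℝ} (hr : 0 < r) (hrT : r < T) (hTt : T ≤ t) (z : ℍ)
    (s : Finset ℍ) (hsep : ∀ w ∈ s, ∀ w' ∈ s, w ≠ w' → 2 * r ≤ dist w w')
    (hT : ∀ w ∈ s, T ≤ dist z w) (ht : ∀ w ∈ s, dist z w ≤ t) :
    (s.card : ℝ) * (Real.cosh r - 1) ≤ Real.cosh (t + r) - Real.cosh (T - r) := by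
  have hdisj : Disjoint (⋃ w ∈ s, Metric.ball w r) (Metric.ball z (T - r)) := by
    rw [disjoint_iUnion₂_left]
    intro w hw
    refine Metric.ball_disjoint_ball ?_
    rw [dist_comm]
    linarith [hT w hw]
  have hsub : (⋃ w ∈ s, Metric.ball w r) ∪ Metric.ball z (T - r) ⊆ Metric.ball z (t + r) := by
    refine union_subset (iUnion₂_subset fun w hw ↦ Metric.ball_subset_ball' ?_)
      (Metric.ball_subset_ball (by linarith))
    rw [dist_comm]
    linarith [ht w hw]
  have h := measure_mono (μ := volume) hsub
  rw [measure_union hdisj measurableSet_ball, measure_biUnion_finset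
    (fun w hw w' hw' hne ↦ Metric.ball_disjoint_ball (by linarith [hsep w hw w' hw' hne]))
    (fun _ _ ↦ measurableSet_ball)] at h
  simp only [volume_hyperbolic_ball _ hr, volume_hyperbolic_ball z (sub_pos.2 hrT),
    volume_hyperbolic_ball z (show 0 < t + r by linarith), Finset.sum_const, nsmul_eq_mul] at h
  have hr₁ := sub_nonneg.2 (Real.one_le_cosh r)
  have hr₂ := sub_nonneg.2 (Real.one_le_cosh (T - r))
  have hr₃ := sub_nonneg.2 (Real.one_le_cosh (t + r))
  rw [← ENNReal.ofReal_natCast, ← ENNReal.ofReal_mul (by positivity),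
    ← ENNReal.ofReal_add (by positivity) (by positivity),
    ENNReal.ofReal_le_ofReal_iff (by positivity)] at h
  have hpi := Real.pi_pos
  refine le_of_mul_le_mul_left ?_ (show 0 < 2 * Real.pi by positivity)
  linarith

open MeasureTheory Set in
/-- Summation by parts: a linear bound in `exp t` for the number of `w ∈ s` with `d w ≤ t` gives a
bound for the sum of `exp (-(1 + δ) * d w)`. -/
lemma sum_exp_neg_le_of_card_le {ι : Type*} (s : Finset ι) (d : ι → ℝ) {δ T α β : ℝ} (hδ : 0 < δ)
    (hd : ∀ w ∈ s, T ≤ d w)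
    (hcard : ∀ t, T ≤ t → ((s.filter fun w ↦ d w ≤ t).card : ℝ) ≤ α + β * Real.exp t) :
    ∑ w ∈ s, Real.exp (-(1 + δ) * d w) ≤
      α * Real.exp (-(1 + δ) * T) + β * ((1 + δ) / δ) * Real.exp (-δ * T) := by
  have ha : -(1 + δ) < 0 := by linarith
  let g : ℝ → ℝ := fun t ↦ (1 + δ) * Real.exp (-(1 + δ) * t)
  have hg : ∀ T, IntegrableOn g (Ioi T) := fun T ↦ (integrableOn_exp_mul_Ioi ha T).const_mul _
  have hgI : ∀ T, ∫ t in Ioi T, g t = Real.exp (-(1 + δ) * T) := by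
    intro T
    rw [integral_const_mul, integral_exp_mul_Ioi ha]
    field_simp
  have hterm : ∀ w ∈ s, Real.exp (-(1 + δ) * d w) = ∫ t in Ioi T, (Ioi (d w)).indicator g t := by
    intro w hw
    rw [setIntegral_indicator measurableSet_Ioi,
      inter_eq_self_of_subset_right (Ioi_subset_Ioi (hd w hw)), hgI]
  have hg_exp : ∀ t, g t * Real.exp t = (1 + δ) * Real.exp (-δ * t) := by
    intro t
    simp only [g]
    rw [mul_assoc, ← Real.exp_add]
    ring_nf
  have hgd : IntegrableOn (fun t ↦ g t * Real.exp t) (Ioi T) := by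
    simp_rw [hg_exp]
    exact (integrableOn_exp_mul_Ioi (by linarith) T).const_mul _
  have hrhs : ∫ t in Ioi T, (α * g t + β * (g t * Real.exp t)) =
      α * Real.exp (-(1 + δ) * T) + β * ((1 + δ) / δ) * Real.exp (-δ * T) := by
    have hgdI : ∫ t in Ioi T, g t * Real.exp t = (1 + δ) / δ * Real.exp (-δ * T) := by
      simp_rw [hg_exp]
      rw [integral_const_mul, integral_exp_mul_Ioi (by linarith)]
      field_simp
    rw [integral_add ((hg T).const_mul _) (hgd.const_mul _), integral_const_mul α g,
      integral_const_mul β fun t ↦ g t * Real.exp t, hgI, hgdI, mul_assoc β]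
  have hind : ∀ w ∈ s, IntegrableOn ((Ioi (d w)).indicator g) (Ioi T) := fun w hw ↦
    (hg T).indicator measurableSet_Ioi
  rw [Finset.sum_congr rfl hterm, ← hrhs, ← integral_finsetSum s hind]
  refine setIntegral_mono_on (integrable_finsetSum s hind)
    (((hg T).const_mul _).add (hgd.const_mul _)) measurableSet_Ioi fun t ht ↦ ?_
  have hgt : 0 ≤ g t := by positivity
  have hsum : ∑ w ∈ s, (Ioi (d w)).indicator g t ≤
      ((s.filter fun w ↦ d w ≤ t).card : ℝ) * g t := by
    rw [← nsmul_eq_mul, ← Finset.sum_const, Finset.sum_filter]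
    refine Finset.sum_le_sum fun w _ ↦ ?_
    simp only [indicator, mem_Ioi]
    split_ifs <;> linarith
  calc _ ≤ _ := hsum
    _ ≤ (α + β * Real.exp t) * g t := by
      gcongr
      exact hcard t (le_of_lt ht)
    _ = _ := by ring

lemma cosh_rpow_neg_le (t : ℝ) {δ : ℝ} (hδ : 0 < δ) :
    Real.cosh t ^ (-(1 + δ)) ≤ 2 * (2 : ℝ) ^ δ * Real.exp (-(1 + δ) * t) := by
  have h : Real.exp t / 2 ≤ Real.cosh t := by
    rw [Real.cosh_eq]
    linarith [Real.exp_pos (-t)]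
  refine (Real.rpow_le_rpow_of_nonpos (by positivity) h (by linarith)).trans_eq ?_
  rw [Real.div_rpow (Real.exp_pos t).le zero_le_two, ← Real.exp_mul, Real.rpow_neg zero_le_two,
    Real.rpow_add two_pos, Real.rpow_one, div_inv_eq_mul]
  ring_nf

lemma cosh_add_sub_cosh_sub_le {r t T : ℝ} (hr : 0 ≤ r) (hTt : T ≤ t) :
    Real.cosh (t + r) - Real.cosh (T - r) ≤
      Real.exp T * (Real.sinh r - Real.exp r / 2) + Real.exp r / 2 * Real.exp t := by
  have hs : 0 ≤ Real.exp (-T) * Real.sinh r :=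
    mul_nonneg (Real.exp_pos _).le (Real.sinh_nonneg_iff.2 hr)
  have h : Real.exp (-(t + r)) ≤ Real.exp (-(T + r)) := Real.exp_le_exp.2 (by linarith)
  rw [Real.sinh_eq] at hs ⊢
  rw [Real.cosh_eq, Real.cosh_eq]
  simp only [neg_add, sub_eq_add_neg, neg_neg, Real.exp_add] at *
  linarith

/-- if `S ⊆ ℍ` is `2r`-separated with `r > 0`, then for every `z ∈ ℍ`,
`δ > 0` and `T₀ > r`, the sum `Σ (cosh dist(z,w))^{-(1+δ)}` over points `w ∈ S` with
`dist(z,w) ≥ T₀` converges and is at most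
`e^{-δT₀}·(2^δ e^r/(δ sinh²(r/2)) + 2^δ sinh r / sinh²(r/2))`. -/
theorem separated_set_cosh_sum_bound
    (r : ℝ) (hr : 0 < r) (S : Set ℍ)
    (hsep : ∀ w ∈ S, ∀ w' ∈ S, w ≠ w' → 2 * r ≤ dist w w')
    (z : ℍ) (δ T₀ : ℝ) (hδ : 0 < δ) (hT₀ : r < T₀) :
    Summable (fun w : {w : ℍ // w ∈ S ∧ T₀ ≤ dist z w} =>
        Real.cosh (dist z (w : ℍ)) ^ (-(1 + δ))) ∧
      (∑' w : {w : ℍ // w ∈ S ∧ T₀ ≤ dist z w},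
          Real.cosh (dist z (w : ℍ)) ^ (-(1 + δ))) ≤
        Real.exp (-δ * T₀) *
          ((2 : ℝ) ^ δ * Real.exp r / (δ * Real.sinh (r / 2) ^ 2) +
            (2 : ℝ) ^ δ * Real.sinh r / Real.sinh (r / 2) ^ 2) := by
  have hnonneg : ∀ w : {w : ℍ // w ∈ S ∧ T₀ ≤ dist z w},
      0 ≤ Real.cosh (dist z (w : ℍ)) ^ (-(1 + δ)) := fun w ↦
    Real.rpow_nonneg (Real.cosh_pos _).le _
  have hsinh : 0 < Real.sinh (r / 2) := Real.sinh_pos_iff.2 (by linarith)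
  have hcosh : Real.cosh r - 1 = 2 * Real.sinh (r / 2) ^ 2 := by
    have h₁ := Real.cosh_two_mul (r / 2)
    rw [mul_div_cancel₀ r two_ne_zero] at h₁
    linarith [Real.cosh_sq (r / 2)]
  set k := Real.sinh (r / 2) ^ 2
  have hk_pos : 0 < k := by positivity
  have hsum : ∀ s : Finset {w : ℍ // w ∈ S ∧ T₀ ≤ dist z w},
      ∑ w ∈ s, Real.cosh (dist z (w : ℍ)) ^ (-(1 + δ)) ≤
        Real.exp (-δ * T₀) * ((2 : ℝ) ^ δ * Real.exp r / (δ * k) +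
          (2 : ℝ) ^ δ * Real.sinh r / k) := by
    intro s
    have hcard : ∀ t, T₀ ≤ t → ((s.filter fun w ↦ dist z w.1 ≤ t).card : ℝ) ≤
        Real.exp T₀ * (Real.sinh r - Real.exp r / 2) / (2 * k) +
          Real.exp r / (4 * k) * Real.exp t := by
      intro t ht
      have h := card_separated_mul_le hr hT₀ ht z
        ((s.filter fun w ↦ dist z w.1 ≤ t).map (.subtype fun w ↦ w ∈ S ∧ T₀ ≤ dist z w))
        (by
          simp only [Finset.mem_map, forall_exists_index, and_imp]
          rintro _ w - rfl _ w' - rfl hne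
          exact hsep _ w.2.1 _ w'.2.1 hne)
        (by
          simp only [Finset.mem_map, forall_exists_index, and_imp]
          rintro _ w - rfl
          exact w.2.2)
        (by
          simp only [Finset.mem_map, forall_exists_index, and_imp]
          rintro _ w hw rfl
          exact (Finset.mem_filter.1 hw).2)
      rw [Finset.card_map, hcosh] at h
      have h' := (le_div_iff₀ (by positivity)).2 (h.trans (cosh_add_sub_cosh_sub_le hr.le ht))
      refine h'.trans_eq ?_
      field_simp
      ring
    have hexp := sum_exp_neg_le_of_card_le s (fun w ↦ dist z w.1) hδ (fun w _ ↦ w.2.2) hcard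
    have hT : Real.exp T₀ * Real.exp (-(1 + δ) * T₀) = Real.exp (-δ * T₀) := by
      rw [← Real.exp_add]
      ring_nf
    calc ∑ w ∈ s, Real.cosh (dist z (w : ℍ)) ^ (-(1 + δ))
        ≤ ∑ w ∈ s, 2 * (2 : ℝ) ^ δ * Real.exp (-(1 + δ) * dist z (w : ℍ)) :=
          Finset.sum_le_sum fun w _ ↦ cosh_rpow_neg_le _ hδ
      _ = 2 * (2 : ℝ) ^ δ * ∑ w ∈ s, Real.exp (-(1 + δ) * dist z (w : ℍ)) := by
          rw [Finset.mul_sum]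
      _ ≤ 2 * (2 : ℝ) ^ δ * _ := mul_le_mul_of_nonneg_left hexp (by positivity)
      _ = Real.exp (-δ * T₀) * ((2 : ℝ) ^ δ * Real.exp r / (2 * δ * k) +
            (2 : ℝ) ^ δ * Real.sinh r / k) := by
          rw [← hT]
          field_simp
          ring
      _ ≤ _ := by
          gcongr
          linarith
  exact ⟨summable_of_sum_le hnonneg hsum, Real.tsum_le_of_sum_le hnonneg hsum⟩
end

section
/- Let Γ be a subgroup of SL(2, ℝ) that is discrete (carries the discrete topology as a subspace of SL(2, ℝ)), let ω > 0, and suppose the parabolic element T = [[1, ω], [0, 1]] belongs to Γ. Let Γ_∞ denote the cyclic subgroup of Γ generated by T. Fix z ∈ ℍ and assume there exists y₀ > 0 such that Im(η·z) ≤ y₀ for all η ∈ Γ. Then Im(η·z) depends only on the coset Γ_∞ η in Γ_∞\Γ, and for every real σ > 1 the parabolic Eisenstein series Σ_{Γ_∞ η ∈ Γ_∞\Γ} (Im(η·z))^σ converges (the family is summable). -/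
open Matrix MatrixGroups UpperHalfPlane

/-- The parabolic element `[[1, ω], [0, 1]]` of `SL(2, ℝ)`. -/
noncomputable def parabolicElt (ω : ℝ) : SL(2, ℝ) :=
  ⟨!![1, ω; 0, 1], by simp [Matrix.det_fin_two_of]⟩

/-- The topology on `SL(2, ℝ)` induced from the (product) topology on `2 × 2` real
matrices, so that a subgroup is discrete iff it is discrete as a set of matrices. -/
instance : TopologicalSpace SL(2, ℝ) :=
  TopologicalSpace.induced (fun g : SL(2, ℝ) => (g : Matrix (Fin 2) (Fin 2) ℝ))
    inferInstance

lemma parabolicElt_smul (ω : ℝ) (w : ℍ) : parabolicElt ω • w = ω +ᵥ w := by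
  rw [UpperHalfPlane.ext_iff, coe_vadd, coe_specialLinearGroup_apply]
  simp [parabolicElt, add_comm]

lemma parabolicElt_zpow_smul (ω : ℝ) (n : ℤ) (w : ℍ) :
    parabolicElt ω ^ n • w = (n * ω : ℝ) +ᵥ w := by
  induction n with
  | zero => simp
  | succ n ih =>
    rw [add_comm, _root_.zpow_add, zpow_one, mul_smul, ih, parabolicElt_smul, vadd_vadd]
    push_cast
    ring_nf
  | pred n ih =>
    rw [sub_eq_neg_add, _root_.zpow_add, _root_.zpow_neg_one, mul_smul, ih, inv_smul_eq_iff,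
      parabolicElt_smul, vadd_vadd]
    push_cast
    ring_nf

/-- Only finitely many elements of a discrete subgroup move a point by a bounded distance. -/
lemma finite_setOf_dist_smul_le (Γ : Subgroup SL(2, ℝ)) [hΓ : DiscreteTopology Γ] (z : ℍ) (r : ℝ) :
    {γ : Γ | dist ((γ : SL(2, ℝ)) • z) z ≤ r}.Finite := by
  have : ProperlyDiscontinuousSMul Γ ℍ :=
    @instProperlyDiscontinuousSL2RSubgroup Γ hΓ
  refine (ProperlyDiscontinuousSMul.finite_disjoint_inter_image (Γ := Γ)
    (isCompact_singleton (x := z)) (isCompact_closedBall z r)).subset fun γ hγ ↦ ?_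
  rw [Set.mem_ofPred_eq, Set.image_singleton]
  exact ⟨γ • z, rfl, hγ⟩

/-- Points in a common box `[m h, (m + 1) h) × (h / 2, h]` are at bounded hyperbolic distance. -/
lemma dist_le_ten_of_floor_eq {h : ℝ} (hh : 0 < h) {w w' : ℍ} (h₁ : h / 2 < w.im) (h₂ : w.im ≤ h)
    (h₁' : h / 2 < w'.im) (h₂' : w'.im ≤ h) (hw : 0 ≤ w.re) (hw' : 0 ≤ w'.re)
    (hre : ⌊w.re / h⌋₊ = ⌊w'.re / h⌋₊) : dist w w' ≤ 10 := by
  have key : (w.re - w'.re) ^ 2 ≤ h ^ 2 := by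
    have a₁ := Nat.floor_le (div_nonneg hw hh.le)
    have a₂ := Nat.lt_floor_add_one (w.re / h)
    have b₁ := Nat.floor_le (div_nonneg hw' hh.le)
    have b₂ := Nat.lt_floor_add_one (w'.re / h)
    rw [le_div_iff₀ hh] at a₁ b₁
    rw [div_lt_iff₀ hh] at a₂ b₂
    rw [hre] at a₁ a₂
    exact sq_le_sq' (by linarith) (by linarith)
  have hcosh : Real.cosh (dist w w') ≤ 5 := by
    rw [cosh_dist', div_le_iff₀ (by positivity)]
    nlinarith [mul_pos (sub_pos.2 h₁) (sub_pos.2 h₁'),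
      mul_nonneg (sub_nonneg.2 h₂) (sub_pos.2 h₁').le,
      mul_nonneg (sub_nonneg.2 h₂') (sub_pos.2 h₁).le]
  rw [Real.cosh_eq] at hcosh
  linarith [Real.add_one_le_exp (dist w w'), Real.exp_pos (-dist w w')]

/-- The series `∑ hₖ ^ σ` over a family of boxes of height `hₖ = y₀ 2⁻ᵏ`, with `O(2ᵏ)` boxes of
each height, converges. -/
lemma summable_sigma_rpow (M : ℕ) {y₀ σ : ℝ} (hy₀ : 0 < y₀) (hσ : 1 < σ) :
    Summable fun c : Σ k : ℕ, Fin (M * 2 ^ k) ↦ (y₀ * (1 / 2) ^ c.1) ^ σ := by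
  refine (summable_sigma_of_nonneg fun c ↦ by positivity).2 ⟨fun k ↦ Summable.of_finite, ?_⟩
  have hlt : 2 * (1 / 2 : ℝ) ^ σ < 1 := by
    have := Real.rpow_lt_rpow_of_exponent_gt (x := 1 / 2) (by norm_num) (by norm_num) hσ
    rw [Real.rpow_one] at this
    linarith
  refine ((summable_geometric_of_lt_one (by positivity) hlt).mul_left (M * y₀ ^ σ)).congr
    fun k ↦ ?_
  symm
  simp only [tsum_fintype]
  rw [Finset.sum_const, Finset.card_univ, Fintype.card_fin, nsmul_eq_mul,
    Real.mul_rpow hy₀.le (by positivity), ← Real.rpow_pow_comm (by norm_num), mul_pow]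
  push_cast
  ring

/-- let `Γ ≤ SL(2,ℝ)` be discrete, containing the parabolic element
`T = [[1,ω],[0,1]]` with `ω > 0`, and let `Γ_∞ = ⟨T⟩`. Fix `z ∈ ℍ` and suppose
`Im(ηz) ≤ y₀` for some `y₀ > 0` and all `η ∈ Γ`. Then `Im(ηz)` depends only on the coset
`Γ_∞η`, and for every real `σ > 1` the parabolic Eisenstein series
`Σ_{Γ_∞η ∈ Γ_∞\Γ} (Im(ηz))^σ` is summable. -/
theorem parabolic_eisenstein_summable
    (Γ : Subgroup SL(2, ℝ)) [DiscreteTopology Γ] (ω : ℝ) (hω : 0 < ω)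
    (hT : parabolicElt ω ∈ Γ) (z : ℍ)
    (y₀ : ℝ) (hy₀ : 0 < y₀) (hbound : ∀ η : Γ, ((η : SL(2, ℝ)) • z).im ≤ y₀)
    (σ : ℝ) (hσ : 1 < σ) :
    ∃ F : Quotient (QuotientGroup.rightRel
        (Subgroup.zpowers (⟨parabolicElt ω, hT⟩ : Γ))) → ℝ,
      (∀ η : Γ,
        F (Quotient.mk (QuotientGroup.rightRel
            (Subgroup.zpowers (⟨parabolicElt ω, hT⟩ : Γ))) η) =
          ((η : SL(2, ℝ)) • z).im ^ σ) ∧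
      Summable F := by
  have mk_eq (n : ℤ) (η : Γ) :
      (Quotient.mk (QuotientGroup.rightRel (Subgroup.zpowers (⟨parabolicElt ω, hT⟩ : Γ)))
        ((⟨parabolicElt ω, hT⟩ : Γ) ^ n * η)) = Quotient.mk _ η := by
    refine Quotient.sound (QuotientGroup.rightRel_apply.2 ⟨-n, ?_⟩)
    simp
  let F : Quotient (QuotientGroup.rightRel
      (Subgroup.zpowers (⟨parabolicElt ω, hT⟩ : Γ))) → ℝ :=
    Quotient.lift (fun η : Γ ↦ ((η : SL(2, ℝ)) • z).im ^ σ) (by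
      intro η η' h
      obtain ⟨n, hn⟩ := QuotientGroup.rightRel_apply.1 h
      obtain rfl : η' = (⟨parabolicElt ω, hT⟩ : Γ) ^ n * η := eq_mul_of_mul_inv_eq hn.symm
      simp [mul_smul, parabolicElt_zpow_smul])
  refine ⟨F, fun η ↦ rfl, ?_⟩
  have hrep : ∀ q : Quotient (QuotientGroup.rightRel
      (Subgroup.zpowers (⟨parabolicElt ω, hT⟩ : Γ))), ∃ η : Γ, Quotient.mk _ η = q ∧
      0 ≤ ((η : SL(2, ℝ)) • z).re ∧ ((η : SL(2, ℝ)) • z).re < ω := by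
    refine Quotient.ind fun η ↦ ?_
    obtain ⟨n, hn, -⟩ := existsUnique_add_zsmul_mem_Ico hω ((η : SL(2, ℝ)) • z).re 0
    refine ⟨(⟨parabolicElt ω, hT⟩ : Γ) ^ n * η, mk_eq n η, ?_⟩
    simpa [mul_smul, parabolicElt_zpow_smul, add_comm] using hn
  choose rep hrep hre_nonneg hre_lt using hrep
  have hscale (q) : ∃ k : ℕ, y₀ * (1 / 2) ^ k / 2 < ((rep q : SL(2, ℝ)) • z).im ∧
      ((rep q : SL(2, ℝ)) • z).im ≤ y₀ * (1 / 2) ^ k := by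
    obtain ⟨k, hk, hk'⟩ := exists_nat_pow_near_of_lt_one
      (div_pos ((rep q : SL(2, ℝ)) • z).im_pos hy₀) ((div_le_one hy₀).2 (hbound (rep q)))
      (by norm_num : (0 : ℝ) < 1 / 2) (by norm_num)
    rw [lt_div_iff₀ hy₀, pow_succ] at hk
    rw [div_le_iff₀ hy₀] at hk'
    exact ⟨k, by linarith, by linarith⟩
  choose k hk_lt hk_le using hscale
  obtain ⟨M, hM⟩ := exists_nat_ge (ω / y₀)
  have hcell (q) : ⌊((rep q : SL(2, ℝ)) • z).re / (y₀ * (1 / 2) ^ k q)⌋₊ < M * 2 ^ k q := by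
    rw [Nat.floor_lt (div_nonneg (hre_nonneg q) (by positivity)), div_lt_iff₀ (by positivity)]
    rw [div_le_iff₀ hy₀] at hM
    push_cast
    calc _ < ω := hre_lt q
      _ ≤ M * y₀ := hM
      _ = M * 2 ^ k q * (y₀ * (1 / 2) ^ k q) := by
        rw [_root_.one_div_pow]
        field_simp
  let cell (q) : Σ k : ℕ, Fin (M * 2 ^ k) := ⟨k q, _, hcell q⟩
  have hdist (q q') (h : cell q = cell q') :
      dist ((rep q : SL(2, ℝ)) • z) ((rep q' : SL(2, ℝ)) • z) ≤ 10 := by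
    have hk : k q = k q' := congrArg Sigma.fst h
    have hm : (cell q).2.val = (cell q').2.val := by rw [h]
    have e₁ := hk_lt q
    have e₂ := hk_le q
    simp only [cell, hk] at hm e₁ e₂
    exact dist_le_ten_of_floor_eq (by positivity) e₁ e₂ (hk_lt q') (hk_le q')
      (hre_nonneg q) (hre_nonneg q') hm
  -- Fixing one coset in each nonempty cell, the others differ from it by a finite set of elements.
  have : Nonempty (Quotient (QuotientGroup.rightRel
      (Subgroup.zpowers (⟨parabolicElt ω, hT⟩ : Γ)))) := ⟨Quotient.mk _ 1⟩
  let base (q) := Function.invFunOn cell Set.univ (cell q)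
  have hbase (q) : cell (base q) = cell q := Function.invFunOn_eq ⟨q, Set.mem_univ q, rfl⟩
  let K : Set Γ := {γ | dist ((γ : SL(2, ℝ)) • z) z ≤ 10}
  have : Finite K := finite_setOf_dist_smul_le Γ z 10
  have hK (q) : (rep (base q))⁻¹ * rep q ∈ K := by
    have := hdist q (base q) (hbase q).symm
    rwa [← dist_smul ((rep (base q) : SL(2, ℝ))⁻¹), inv_smul_smul, ← mul_smul] at this
  let Φ (q) : (Σ k : ℕ, Fin (M * 2 ^ k)) × K := (cell q, ⟨_, hK q⟩)
  have hΦ : Function.Injective Φ := by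
    intro q q' h
    have hc : cell q = cell q' := congrArg Prod.fst h
    have hγ : (rep (base q))⁻¹ * rep q = (rep (base q'))⁻¹ * rep q' :=
      congrArg (fun p ↦ (p.2 : Γ)) h
    have hb : base q = base q' := by simp only [base, hc]
    rw [hb, mul_right_inj] at hγ
    rw [← hrep q, hγ, hrep q']
  have hsum := ((summable_sigma_rpow M hy₀ hσ).mul_of_nonneg
    (Summable.of_finite (f := fun _ : K ↦ (1 : ℝ))) (fun c ↦ by positivity)
    (fun _ ↦ zero_le_one)).comp_injective hΦ
  have hF (q) : F q = ((rep q : SL(2, ℝ)) • z).im ^ σ := congrArg F (hrep q).symm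
  refine hsum.of_nonneg_of_le (fun q ↦ ?_) (fun q ↦ ?_)
  · rw [hF]
    exact Real.rpow_nonneg ((rep q : SL(2, ℝ)) • z).im_pos.le σ
  · rw [hF]
    simpa using Real.rpow_le_rpow ((rep q : SL(2, ℝ)) • z).im_pos.le (hk_le q) (by linarith)
end

section
/- For s ∈ ℂ, define h_s : {(x, y) ∈ ℝ² : y > 0} → ℂ by h_s(x, y) = (y / √(x² + y²))^s, the complex power of the positive real number y/√(x² + y²). Then for all x ∈ ℝ and y > 0, y²·( ∂²h_s/∂x² (x, y) + ∂²h_s/∂y² (x, y) ) = −s(1 − s)·h_s(x, y) − s²·h_{s+2}(x, y). Equivalently, writing Δ = −y²(∂²/∂x² + ∂²/∂y²) for the hyperbolic Laplacian, Δ h_s = s(1 − s) h_s + s² h_{s+2}. -/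
/-- The single-term building block of the hyperbolic Eisenstein series:
`h_s(x, y) = (y/√(x² + y²))^s`, a complex power of a positive real number. -/
noncomputable def hypEisensteinTerm (s : ℂ) (x y : ℝ) : ℂ :=
  (((y / Real.sqrt (x ^ 2 + y ^ 2)) : ℝ) : ℂ) ^ s

theorem hypEisensteinTerm_eq_exp (s : ℂ) (x : ℝ) {y : ℝ} (hy : 0 < y) :
    hypEisensteinTerm s x y =
      Complex.exp (s * ((Real.log y - Real.log (x ^ 2 + y ^ 2) / 2 : ℝ) : ℂ)) := by
  have hr : 0 < x ^ 2 + y ^ 2 := by positivity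
  have hq : 0 < y / Real.sqrt (x ^ 2 + y ^ 2) := div_pos hy (Real.sqrt_pos.2 hr)
  rw [hypEisensteinTerm, Complex.cpow_def_of_ne_zero (by exact_mod_cast hq.ne'),
    ← Complex.ofReal_log hq.le, Real.log_div hy.ne' (Real.sqrt_pos.2 hr).ne',
    Real.log_sqrt hr.le, mul_comm]

theorem hypEisensteinTerm_add_two (s : ℂ) (x : ℝ) {y : ℝ} (hy : 0 < y) :
    hypEisensteinTerm (s + 2) x y =
      hypEisensteinTerm s x y * ((y ^ 2 / (x ^ 2 + y ^ 2) : ℝ) : ℂ) := by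
  have hr : 0 < x ^ 2 + y ^ 2 := by positivity
  have hq : 0 < y / Real.sqrt (x ^ 2 + y ^ 2) := div_pos hy (Real.sqrt_pos.2 hr)
  rw [hypEisensteinTerm, Complex.cpow_add _ _ (by exact_mod_cast hq.ne'), hypEisensteinTerm,
    Complex.cpow_ofNat, ← Complex.ofReal_pow, div_pow, Real.sq_sqrt hr.le]

/-- The second derivative of `exp (s * u)` for a real function `u` of a real variable. -/
theorem deriv_deriv_eq_of_eventuallyEq_exp {s : ℂ} {f : ℝ → ℂ} {u v : ℝ → ℝ} {w t : ℝ}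
    (hf : ∀ᶠ a in nhds t, f a = Complex.exp (s * (u a : ℂ)))
    (hu : ∀ᶠ a in nhds t, HasDerivAt u (v a) a) (hv : HasDerivAt v w t) :
    deriv (fun a => deriv f a) t = f t * (s ^ 2 * (v t : ℂ) ^ 2 + s * (w : ℂ)) := by
  have hexp : ∀ a, HasDerivAt u (v a) a → HasDerivAt (fun b => Complex.exp (s * (u b : ℂ)))
      (Complex.exp (s * (u a : ℂ)) * (s * (v a : ℂ))) a :=
    fun a ha => (ha.ofReal_comp.const_mul s).cexp
  have hderiv : (fun a => deriv f a) =ᶠ[nhds t]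
      fun a => Complex.exp (s * (u a : ℂ)) * (s * (v a : ℂ)) := by
    filter_upwards [hf.eventually_nhds, hu] with a hfa hua
    exact ((hexp a hua).congr_of_eventuallyEq hfa).deriv
  rw [hderiv.deriv_eq, hf.self_of_nhds]
  refine ((hexp t hu.self_of_nhds).mul (hv.ofReal_comp.const_mul s)).deriv.trans ?_
  ring

theorem deriv_deriv_hypEisensteinTerm_fst (s : ℂ) (x : ℝ) {y : ℝ} (hy : 0 < y) :
    deriv (fun x' : ℝ => deriv (fun x'' : ℝ => hypEisensteinTerm s x'' y) x') x =
      hypEisensteinTerm s x y * (s ^ 2 * ((-x / (x ^ 2 + y ^ 2) : ℝ) : ℂ) ^ 2 +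
        s * (((x ^ 2 - y ^ 2) / (x ^ 2 + y ^ 2) ^ 2 : ℝ) : ℂ)) := by
  have hr : ∀ a : ℝ, a ^ 2 + y ^ 2 ≠ 0 := fun a => by positivity
  have hd : ∀ a : ℝ, HasDerivAt (fun b : ℝ => b ^ 2 + y ^ 2) (2 * a) a := fun a => by
    simpa using (hasDerivAt_pow 2 a).add_const (y ^ 2)
  refine deriv_deriv_eq_of_eventuallyEq_exp (v := fun a => -a / (a ^ 2 + y ^ 2))
    (.of_forall fun a => hypEisensteinTerm_eq_exp s a hy) (.of_forall fun a => ?_) ?_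
  · refine ((((hd a).log (hr a)).div_const 2).const_sub (Real.log y)).congr_deriv ?_
    field_simp
  · refine ((hasDerivAt_id x).neg.div (hd x) (hr x)).congr_deriv ?_
    simp only [id, Pi.neg_apply]
    field_simp [hr x]
    ring

theorem deriv_deriv_hypEisensteinTerm_snd (s : ℂ) (x : ℝ) {y : ℝ} (hy : 0 < y) :
    deriv (fun y' : ℝ => deriv (fun y'' : ℝ => hypEisensteinTerm s x y'') y') y =
      hypEisensteinTerm s x y * (s ^ 2 * ((y⁻¹ - y / (x ^ 2 + y ^ 2) : ℝ) : ℂ) ^ 2 +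
        s * ((-(y ^ 2)⁻¹ - (x ^ 2 - y ^ 2) / (x ^ 2 + y ^ 2) ^ 2 : ℝ) : ℂ)) := by
  have hr : ∀ a : ℝ, 0 < a → x ^ 2 + a ^ 2 ≠ 0 := fun a ha => by positivity
  have hd : ∀ a : ℝ, HasDerivAt (fun b : ℝ => x ^ 2 + b ^ 2) (2 * a) a := fun a => by
    simpa using (hasDerivAt_pow 2 a).const_add (x ^ 2)
  have hpos : ∀ᶠ a in nhds y, 0 < a := lt_mem_nhds hy
  refine deriv_deriv_eq_of_eventuallyEq_exp (v := fun a => a⁻¹ - a / (x ^ 2 + a ^ 2))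
    (hpos.mono fun a ha => hypEisensteinTerm_eq_exp s x ha) (hpos.mono fun a ha => ?_) ?_
  · refine ((Real.hasDerivAt_log ha.ne').sub
      (((hd a).log (hr a ha)).div_const 2)).congr_deriv ?_
    field_simp
  · refine ((hasDerivAt_inv hy.ne').sub
      ((hasDerivAt_id y).div (hd y) (hr y hy))).congr_deriv ?_
    simp only [id]
    ring

/-- the building block `h_s(x,y) = (y/√(x²+y²))^s` satisfies
`y²(∂²h_s/∂x² + ∂²h_s/∂y²) = −s(1−s)h_s − s²h_{s+2}`, i.e.
`Δh_s = s(1−s)h_s + s²h_{s+2}` for the hyperbolic Laplacian `Δ = −y²(∂²/∂x² + ∂²/∂y²)`. -/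
theorem hypEisensteinTerm_laplacian (s : ℂ) (x y : ℝ) (hy : 0 < y) :
    (y : ℂ) ^ 2 *
        (deriv (fun x' : ℝ => deriv (fun x'' : ℝ => hypEisensteinTerm s x'' y) x') x +
          deriv (fun y' : ℝ => deriv (fun y'' : ℝ => hypEisensteinTerm s x y'') y') y) =
      -(s * (1 - s)) * hypEisensteinTerm s x y - s ^ 2 * hypEisensteinTerm (s + 2) x y := by
  have hr : x ^ 2 + y ^ 2 ≠ 0 := by positivity
  have hc : (x : ℂ) ^ 2 + (y : ℂ) ^ 2 ≠ 0 := by exact_mod_cast hr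
  have hyc : (y : ℂ) ≠ 0 := by exact_mod_cast hy.ne'
  rw [deriv_deriv_hypEisensteinTerm_fst s x hy, deriv_deriv_hypEisensteinTerm_snd s x hy,
    hypEisensteinTerm_add_two s x hy]
  push_cast
  field_simp
  ring
end

section
/- Let s ∈ ℂ with Re(s) > 0. Then for every ε > 0 there exists R > 0 such that for all r ≥ R and all x ≥ 0, ‖ 2^{−s} · exp(s·r) · (cosh(x + r))^{−s} − exp(−s·x) ‖ < ε, where cosh(x + r) is the real hyperbolic cosine and (cosh(x+r))^{−s} and 2^{−s} are complex powers of positive real numbers. In particular, for each fixed x ≥ 0, 2^{−s} e^{rs} (cosh(x + r))^{−s} → e^{−sx} as r → ∞, and this convergence is uniform in x ≥ 0. -/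
theorem ofReal_cpow_eq_exp_log_mul {a : ℝ} (ha : 0 < a) (s : ℂ) :
    (a : ℂ) ^ s = Complex.exp ((Real.log a : ℝ) * s) := by
  rw [Complex.cpow_def_of_ne_zero (by exact_mod_cast ha.ne'), Complex.ofReal_log ha.le]

theorem log_two_add_log_cosh (y : ℝ) :
    Real.log 2 + Real.log (Real.cosh y) = y + Real.log (1 + Real.exp (-(2 * y))) := by
  have h : 2 * Real.cosh y = Real.exp y * (1 + Real.exp (-(2 * y))) := by
    rw [Real.cosh_eq, mul_add, ← Real.exp_add]
    ring_nf
  rw [← Real.log_mul two_ne_zero (Real.cosh_pos y).ne', h,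
    Real.log_mul (Real.exp_pos y).ne' (by positivity), Real.log_exp]

theorem two_cpow_mul_exp_mul_cosh_cpow (s : ℂ) (r x : ℝ) :
    ((2 : ℝ) : ℂ) ^ (-s) * Complex.exp (s * r) * ((Real.cosh (x + r) : ℝ) : ℂ) ^ (-s) =
      Complex.exp (-s * x) *
        Complex.exp (-s * (Real.log (1 + Real.exp (-(2 * (x + r)))) : ℝ)) := by
  have h := congrArg (fun t : ℝ => (t : ℂ)) (log_two_add_log_cosh (x + r))
  simp only [Complex.ofReal_add] at h
  rw [ofReal_cpow_eq_exp_log_mul two_pos, ofReal_cpow_eq_exp_log_mul (Real.cosh_pos _),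
    ← Complex.exp_add, ← Complex.exp_add, ← Complex.exp_add]
  congr 1
  linear_combination (-s) * h

/-- for `Re(s) > 0`, `2^{-s} e^{rs} (cosh(x+r))^{-s} → e^{-sx}` as `r → ∞`,
uniformly in `x ≥ 0`: for every `ε > 0` there is `R > 0` such that for all `r ≥ R` and all
`x ≥ 0`, `‖2^{-s}·exp(s·r)·(cosh(x+r))^{-s} − exp(−s·x)‖ < ε`. -/
theorem cosh_cpow_unif_limit (s : ℂ) (hs : 0 < s.re) :
    ∀ ε : ℝ, 0 < ε → ∃ R : ℝ, 0 < R ∧ ∀ r : ℝ, R ≤ r → ∀ x : ℝ, 0 ≤ x →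
      ‖((2 : ℝ) : ℂ) ^ (-s) * Complex.exp (s * r) *
          ((Real.cosh (x + r) : ℝ) : ℂ) ^ (-s) - Complex.exp (-s * x)‖ < ε := by
  intro ε hε
  have hcont : Continuous fun t : ℝ => Complex.exp (-s * t) := by fun_prop
  obtain ⟨δ, hδ, hexp⟩ := Metric.continuous_iff.1 hcont 0 ε hε
  refine ⟨δ⁻¹, inv_pos.2 hδ, fun r hr x hx => ?_⟩
  have hr0 : 0 < r := (inv_pos.2 hδ).trans_le hr
  set u := Real.exp (-(2 * (x + r))) with hu
  have hu0 : 0 < u := Real.exp_pos _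
  have huδ : u < δ := by
    rw [hu, Real.exp_neg]
    refine inv_lt_of_inv_lt₀ hδ ?_
    linarith [Real.add_one_le_exp (2 * (x + r))]
  have hlog0 : 0 ≤ Real.log (1 + u) := Real.log_nonneg (by linarith)
  have hlogδ : Real.log (1 + u) < δ := by
    linarith [Real.log_le_sub_one_of_pos (show 0 < 1 + u by positivity)]
  have hsmall := hexp (Real.log (1 + u)) (by rwa [Real.dist_0_eq_abs, abs_of_nonneg hlog0])
  rw [dist_eq_norm, Complex.ofReal_zero, mul_zero, Complex.exp_zero] at hsmall
  have hle : ‖Complex.exp (-s * x)‖ ≤ 1 := by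
    rw [Complex.norm_exp, Real.exp_le_one_iff]
    simpa using mul_nonneg hs.le hx
  rw [two_cpow_mul_exp_mul_cosh_cpow, ← mul_sub_one, norm_mul]
  exact (mul_le_of_le_one_left (norm_nonneg _) hle).trans_lt hsmall
end
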